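/- Let (C•,d) be a cochain complex in 𝒞 and let C̄• be a graded lift of C• along F. Suppose (D̄•,d̄_D) is a cochain complex in 𝒞̄ and φ : (C•,d) → F(D̄•,d̄_D) is a homotopy equivalence. Then there exists a differential d̄ on C̄• with F(d̄) = d together with a homotopy equivalence ψ : (C̄•,d̄) → (D̄•,d̄_D) such that F(ψ)∘... agrees with φ up to homotopy, i.e. F(ψ) is homotopic to φ. In particular, every lift of (C•,d) along the induced functor K(F) between homotopy categories is isomorphic in K(𝒞̄) to a lift of the form (C̄•,d̄) on the fixed graded lift C̄•. -/

import Mathlib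

open CategoryTheory

namespace Paper

/-- A graded object: a `ℤ`-indexed family of objects. -/
abbrev GradedObj (A : Type*) [Category A] := ℤ → A

/-- A graded map of degree `n` from `X` to `Y`. -/
abbrev GMap {A : Type*} [Category A] (X Y : GradedObj A) (n : ℤ) :=
  ∀ i : ℤ, X i ⟶ Y (i + n)

/-- Composition of graded maps, in diagrammatic order (`gcomp h f g` is "`g ∘ f`"),
with prescribed total degree `k = n + m`. -/
def gcomp {A : Type*} [Category A] {X Y Z : GradedObj A} {n m k : ℤ} (h : n + m = k)
    (f : GMap X Y n) (g : GMap Y Z m) : GMap X Z k :=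
  fun i => f i ≫ g (i + n) ≫ eqToHom (congrArg Z (show i + n + m = i + k by omega))

/-- The identity graded map of degree `0`. -/
def gid {A : Type*} [Category A] (X : GradedObj A) : GMap X X 0 :=
  fun i => eqToHom (congrArg X (add_zero i).symm)

/-- `δ(f) = d_Y ∘ f - (-1)ⁿ ⬝ f ∘ d_X` for pre-differentials `d_X`, `d_Y` and a graded
map `f` of degree `n`; the result has degree `m = n + 1`. -/
def gdelta {A : Type*} [Category A] [Preadditive A] {X Y : GradedObj A}
    (dX : GMap X X 1) (dY : GMap Y Y 1) {n m : ℤ} (h : n + 1 = m) (f : GMap X Y n) :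
    GMap X Y m :=
  gcomp h f dY - (n.negOnePow : ℤ) • gcomp (show 1 + n = m by omega) dX f

/-- The image of a graded object under a functor. -/
abbrev Fgr {A B : Type*} [Category A] [Category B] (F : B ⥤ A) (X : GradedObj B) :
    GradedObj A := fun i => F.obj (X i)

/-- The image of a graded map under a functor. -/
def Fmap {A B : Type*} [Category A] [Category B] (F : B ⥤ A) {X Y : GradedObj B} {n : ℤ}
    (f : GMap X Y n) : GMap (Fgr F X) (Fgr F Y) n := fun i => F.map (f i)

/-- `Ker(F)² = 0`: the composite of two `F`-killed morphisms vanishes. -/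
def KerSq {A B : Type*} [Category A] [Category B] [Preadditive A] [Preadditive B]
    (F : B ⥤ A) : Prop :=
  ∀ ⦃X Y Z : B⦄ (u : X ⟶ Y) (v : Y ⟶ Z), F.map u = 0 → F.map v = 0 → u ≫ v = 0

/-- `f : (X,dX) → (Y,dY)` and `g : (Y,dY) → (X,dX)` are cochain maps which are homotopy
inverse to each other. -/
def IsHomotopyEquivPair {A : Type*} [Category A] [Preadditive A] {X Y : GradedObj A}
    (dX : GMap X X 1) (dY : GMap Y Y 1) (f : GMap X Y 0) (g : GMap Y X 0) : Prop :=
  gdelta dX dY (show (0:ℤ) + 1 = 1 by omega) f = 0 ∧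
  gdelta dY dX (show (0:ℤ) + 1 = 1 by omega) g = 0 ∧
  (∃ H : GMap X X (-1), gdelta dX dX (show (-1:ℤ) + 1 = 0 by omega) H
      = gid X - gcomp (show (0:ℤ) + 0 = 0 by omega) f g) ∧
  (∃ K : GMap Y Y (-1), gdelta dY dY (show (-1:ℤ) + 1 = 0 by omega) K
      = gid Y - gcomp (show (0:ℤ) + 0 = 0 by omega) g f)


section Unit

variable {A : Type*} [Category A] {X Y : GradedObj A} {n : ℤ}

lemma gid_gcomp (f : GMap X Y n) : gcomp (zero_add n) (gid X) f = f := by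
  funext i
  have key : ∀ (j : ℤ) (h : i = j),
      eqToHom (congrArg X h) ≫ f j ≫ eqToHom (congrArg (fun t => Y (t + n)) h.symm) = f i := by
    rintro _ rfl
    simp
  exact key (i + 0) (by omega)

lemma gcomp_gid (f : GMap X Y n) : gcomp (add_zero n) f (gid Y) = f := by
  funext i
  simp [gcomp, gid]

end Unit

open Classical in
/-- A graded map `f : X → Y` acts by postcomposition on families of morphisms into all graded
objects, the result being concentrated on `Y`. -/
noncomputable def gactHom {A : Type*} [Category A] [Preadditive A] {X Y : GradedObj A} {n : ℤ}
    (f : GMap X Y n) :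
    (∀ (X : GradedObj A) (i : ℤ) (W : A), W ⟶ X i) →+
      (∀ (X : GradedObj A) (i : ℤ) (W : A), W ⟶ X i) where
  toFun v Y' j W :=
    if h : Y = Y' then
      v X (j - n) W ≫ f (j - n) ≫
        eqToHom ((congrArg Y (sub_add_cancel j n)).trans (congrFun h j))
    else 0
  map_zero' := by
    funext Y' j W
    by_cases h : Y = Y' <;> simp [h]
  map_add' v w := by
    funext Y' j W
    by_cases h : Y = Y' <;> simp [h]

/-- The action `gactHom` as an additive map into a ring, in which compositions of graded maps of
any degree become products. -/
noncomputable def gact {A : Type*} [Category A] [Preadditive A] {X Y : GradedObj A} {n : ℤ} :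
    GMap X Y n →+ AddMonoid.End (∀ (X : GradedObj A) (i : ℤ) (W : A), W ⟶ X i) where
  toFun := gactHom
  map_zero' := AddMonoidHom.ext fun v => by
    funext Y' j W
    change gactHom (0 : GMap X Y n) v Y' j W = 0
    by_cases h : Y = Y' <;> simp [gactHom, h]
  map_add' f g := AddMonoidHom.ext fun v => by
    funext Y' j W
    change gactHom (f + g) v Y' j W = gactHom f v Y' j W + gactHom g v Y' j W
    by_cases h : Y = Y' <;> simp [gactHom, h]

section GradedMaps

variable {A : Type*} [Category A] [Preadditive A] {X Y Z : GradedObj A} {n m k : ℤ}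

lemma gact_apply_self (f : GMap X Y n) (v : ∀ (X : GradedObj A) (i : ℤ) (W : A), W ⟶ X i)
    (i : ℤ) (W : A) : gact f v Y (i + n) W = v X i W ≫ f i := by
  have key : ∀ (i' : ℤ) (h : i' = i),
      v X i' W ≫ f i' ≫ eqToHom (congrArg (fun t => Y (t + n)) h) = v X i W ≫ f i := by
    rintro _ rfl
    simp
  change gactHom f v Y (i + n) W = _
  simpa [gactHom] using key (i + n - n) (by omega)

lemma gact_apply_of_ne (f : GMap X Y n) (v : ∀ (X : GradedObj A) (i : ℤ) (W : A), W ⟶ X i)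
    {Y' : GradedObj A} (h : Y ≠ Y') (j : ℤ) (W : A) : gact f v Y' j W = 0 := by
  change gactHom f v Y' j W = 0
  simp [gactHom, h]

lemma gact_injective :
    Function.Injective (gact : GMap X Y n →+ AddMonoid.End
      (∀ (X : GradedObj A) (i : ℤ) (W : A), W ⟶ X i)) := by
  classical
  intro f g h
  funext i
  have key := congrFun (congrFun (congrFun (DFunLike.congr_fun h
    (Pi.single X (Pi.single i (Pi.single (M := fun W => W ⟶ X i) (X i) (𝟙 (X i)))))) Y)
    (i + n)) (X i)
  simpa [gact_apply_self] using key

lemma gact_gcomp (h : n + m = k) (f : GMap X Y n) (g : GMap Y Z m) :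
    gact (gcomp h f g) = gact g * gact f := by
  subst h
  ext v Z' j W
  by_cases hZ : Z = Z'
  · subst hZ
    obtain ⟨i, rfl⟩ : ∃ i, j = i + (n + m) := ⟨j - (n + m), by omega⟩
    have key : ∀ (w : ∀ (X : GradedObj A) (i : ℤ) (W : A), W ⟶ X i) (a b : ℤ) (hab : a = b),
        w Z b W = w Z a W ≫ eqToHom (congrArg Z hab) := by
      rintro w a _ rfl
      simp
    rw [gact_apply_self, AddMonoid.End.coe_mul, Function.comp_apply,
      key (gact g (gact f v)) (i + n + m) (i + (n + m)) (by omega),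
      gact_apply_self, gact_apply_self]
    simp [gcomp]
  · rw [AddMonoid.End.coe_mul, Function.comp_apply, gact_apply_of_ne _ _ hZ, gact_apply_of_ne _ _ hZ]

lemma gact_mul_gid (f : GMap X Y n) : gact f * gact (gid X) = gact f := by
  rw [← gact_gcomp (zero_add n), gid_gcomp]

lemma gact_gid_mul (f : GMap X Y n) : gact (gid Y) * gact f = gact f := by
  rw [← gact_gcomp (add_zero n), gcomp_gid]

lemma gact_gdelta_zero (dX : GMap X X 1) (dY : GMap Y Y 1) (h : (0 : ℤ) + 1 = 1)
    (f : GMap X Y 0) : gact (gdelta dX dY h f) = gact dY * gact f - gact f * gact dX := by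
  simp [gdelta, gact_gcomp]

lemma gact_gdelta_neg_one (dX : GMap X X 1) (dY : GMap Y Y 1) (h : (-1 : ℤ) + 1 = 0)
    (f : GMap X Y (-1)) :
    gact (gdelta dX dY h f) = gact dY * gact f + gact f * gact dX := by
  simp [gdelta, gact_gcomp]

lemma gcomp_zero (h : n + m = k) (f : GMap X Y n) : gcomp h f (0 : GMap Y Z m) = 0 := by
  funext i
  simp [gcomp]

lemma zero_gcomp (h : n + m = k) (g : GMap Y Z m) : gcomp h (0 : GMap X Y n) g = 0 := by
  funext i
  simp [gcomp]

end GradedMaps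

section Image

variable {A B : Type*} [Category A] [Category B] (F : B ⥤ A) {X Y Z : GradedObj B} {n m k : ℤ}

lemma Fmap_gcomp (h : n + m = k) (f : GMap X Y n) (g : GMap Y Z m) :
    Fmap F (gcomp h f g) = gcomp h (Fmap F f) (Fmap F g) := by
  funext i
  simp [Fmap, gcomp, eqToHom_map]

lemma Fmap_gid : Fmap F (gid X) = gid (Fgr F X) := by
  funext i
  simp [Fmap, gid, eqToHom_map]

lemma Fmap_surjective [F.Full] (f : GMap (Fgr F X) (Fgr F Y) n) :
    ∃ g : GMap X Y n, Fmap F g = f :=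
  ⟨fun i => F.preimage (f i), by funext i; simp [Fmap]⟩

end Image

section Functor

variable {A B : Type*} [Category A] [Preadditive A] [Category B] [Preadditive B]
  (F : B ⥤ A) {X Y Z : GradedObj B} {n m k : ℤ}

lemma KerSq.gact_mul_eq_zero {F : B ⥤ A} (hF : KerSq F) {u : GMap X Y n} {v : GMap Y Z m}
    (hu : Fmap F u = 0) (hv : Fmap F v = 0) : gact v * gact u = 0 := by
  have h : gcomp rfl u v = 0 := by
    funext i
    rw [gcomp, ← Category.assoc, hF _ _ (congrFun hu i) (congrFun hv (i + n))]
    simp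
  rw [← gact_gcomp rfl, h, map_zero]

variable [F.Additive]

lemma Fmap_add (f g : GMap X Y n) : Fmap F (f + g) = Fmap F f + Fmap F g := by
  funext i
  simp [Fmap]

lemma Fmap_sub (f g : GMap X Y n) : Fmap F (f - g) = Fmap F f - Fmap F g := by
  funext i
  simp [Fmap]

lemma Fmap_gdelta (dX : GMap X X 1) (dY : GMap Y Y 1) (h : n + 1 = m) (f : GMap X Y n) :
    Fmap F (gdelta dX dY h f) = gdelta (Fmap F dX) (Fmap F dY) h (Fmap F f) := by
  rw [gdelta, gdelta, Fmap_sub, ← Fmap_gcomp, ← Fmap_gcomp]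
  congr 1
  funext i
  simp [Fmap]

end Functor

section Lifting

variable {A B : Type*} [Category A] [Preadditive A] [Category B] [Preadditive B]
  {F : B ⥤ A} [F.Additive] {X Y : GradedObj B}

/-- The obstruction to lifting a differential vanishes when the complex is homotopy equivalent to
one whose differential lifts. -/
lemma KerSq.exists_differential (hF : KerSq F) (D : GMap X X 1) (dY : GMap Y Y 1)
    (f : GMap X Y 0) (g : GMap Y X 0) (H : GMap X X (-1))
    (hD : gcomp (one_add_one_eq_two (R := ℤ)) (Fmap F D) (Fmap F D) = 0)
    (hdY : gcomp (one_add_one_eq_two (R := ℤ)) dY dY = 0)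
    (hf : gdelta (Fmap F D) (Fmap F dY) (show (0 : ℤ) + 1 = 1 by omega) (Fmap F f) = 0)
    (hg : gdelta (Fmap F dY) (Fmap F D) (show (0 : ℤ) + 1 = 1 by omega) (Fmap F g) = 0)
    (hH : gdelta (Fmap F D) (Fmap F D) (show (-1 : ℤ) + 1 = 0 by omega) (Fmap F H)
      = gid (Fgr F X) - gcomp (show (0 : ℤ) + 0 = 0 by omega) (Fmap F f) (Fmap F g)) :
    ∃ d : GMap X X 1, Fmap F d = Fmap F D ∧
      gcomp (one_add_one_eq_two (R := ℤ)) d d = 0 := by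
  let q := gcomp (one_add_one_eq_two (R := ℤ)) D D
  let e := gdelta D dY (show (0 : ℤ) + 1 = 1 by omega) f
  let s := gdelta dY D (show (0 : ℤ) + 1 = 1 by omega) g
  let p := gdelta D D (show (-1 : ℤ) + 1 = 0 by omega) H
    - (gid X - gcomp (show (0 : ℤ) + 0 = 0 by omega) f g)
  let a := gcomp (show (1 : ℤ) + 0 = 1 by omega) e g
    - gcomp (show (2 : ℤ) + -1 = 1 by omega) q H
  have hq : Fmap F q = 0 := by rw [Fmap_gcomp, hD]
  have he : Fmap F e = 0 := by rw [Fmap_gdelta, hf]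
  have hs : Fmap F s = 0 := by rw [Fmap_gdelta, hg]
  have hp : Fmap F p = 0 := by
    rw [Fmap_sub, Fmap_sub, Fmap_gdelta, Fmap_gid, Fmap_gcomp, hH, sub_self]
  have ha : Fmap F a = 0 := by
    rw [Fmap_sub, Fmap_gcomp, Fmap_gcomp, he, hq, zero_gcomp, zero_gcomp, sub_zero]
  refine ⟨D + a, by rw [Fmap_add, ha, add_zero], gact_injective ?_⟩
  have haa := hF.gact_mul_eq_zero ha ha
  have hse := hF.gact_mul_eq_zero he hs
  have hpq := hF.gact_mul_eq_zero hq hp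
  have hu := gact_gid_mul D
  have hyy := congrArg gact hdY
  simp only [a, s, e, p, q, gact_gcomp, gact_gdelta_zero, gact_gdelta_neg_one, map_sub, map_add,
    map_zero] at haa hse hpq hu hyy ⊢
  linear_combination (norm := (
      simp only [mul_sub, sub_mul, mul_add, add_mul, mul_assoc, mul_zero, zero_mul]; abel))
      haa + hse + gact g * hyy * gact f - hpq - hu * gact D

/-- A homotopy equivalence lifts to a cochain map after changing the lift of the differential of
its source. -/
lemma KerSq.exists_cochainMap (hF : KerSq F) (D : GMap X X 1) (dY : GMap Y Y 1)
    (f : GMap X Y 0) (g : GMap Y X 0) (K : GMap Y Y (-1))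
    (hD : gcomp (one_add_one_eq_two (R := ℤ)) D D = 0)
    (hdY : gcomp (one_add_one_eq_two (R := ℤ)) dY dY = 0)
    (hf : gdelta (Fmap F D) (Fmap F dY) (show (0 : ℤ) + 1 = 1 by omega) (Fmap F f) = 0)
    (hg : gdelta (Fmap F dY) (Fmap F D) (show (0 : ℤ) + 1 = 1 by omega) (Fmap F g) = 0)
    (hK : gdelta (Fmap F dY) (Fmap F dY) (show (-1 : ℤ) + 1 = 0 by omega) (Fmap F K)
      = gid (Fgr F Y) - gcomp (show (0 : ℤ) + 0 = 0 by omega) (Fmap F g) (Fmap F f)) :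
    ∃ (d : GMap X X 1) (ψ : GMap X Y 0), Fmap F d = Fmap F D ∧ Fmap F ψ = Fmap F f ∧
      gcomp (one_add_one_eq_two (R := ℤ)) d d = 0 ∧
      gdelta d dY (show (0 : ℤ) + 1 = 1 by omega) ψ = 0 := by
  let e := gdelta D dY (show (0 : ℤ) + 1 = 1 by omega) f
  let s := gdelta dY D (show (0 : ℤ) + 1 = 1 by omega) g
  let p := gdelta dY dY (show (-1 : ℤ) + 1 = 0 by omega) K
    - (gid Y - gcomp (show (0 : ℤ) + 0 = 0 by omega) g f)
  let a := gcomp (show (1 : ℤ) + 0 = 1 by omega) e g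
  let b := gcomp (show (1 : ℤ) + -1 = 0 by omega) e K
  have he : Fmap F e = 0 := by rw [Fmap_gdelta, hf]
  have hs : Fmap F s = 0 := by rw [Fmap_gdelta, hg]
  have hp : Fmap F p = 0 := by
    rw [Fmap_sub, Fmap_sub, Fmap_gdelta, Fmap_gid, Fmap_gcomp, hK, sub_self]
  have ha : Fmap F a = 0 := by rw [Fmap_gcomp, he, zero_gcomp]
  have hb : Fmap F b = 0 := by rw [Fmap_gcomp, he, zero_gcomp]
  have haa := hF.gact_mul_eq_zero ha ha
  have hea := hF.gact_mul_eq_zero ha he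
  have hse := hF.gact_mul_eq_zero he hs
  have hpe := hF.gact_mul_eq_zero he hp
  have hvy := gact_gid_mul dY
  have hvf := gact_gid_mul f
  have hdd := congrArg gact hD
  have hyy := congrArg gact hdY
  refine ⟨D + a, f - b, by rw [Fmap_add, ha, add_zero], by rw [Fmap_sub, hb, sub_zero],
    gact_injective ?_, gact_injective ?_⟩ <;>
  simp only [a, b, s, e, p, gact_gcomp, gact_gdelta_zero, gact_gdelta_neg_one, map_sub, map_add,
    map_zero] at haa hea hse hpe hdd hyy ⊢
  · linear_combination (norm := (
      simp only [mul_sub, sub_mul, mul_add, add_mul, mul_assoc, mul_zero, zero_mul]; abel))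
      hdd + hse + gact g * hyy * gact f
      - gact g * gact f * hdd + haa
  · linear_combination (norm := (
      simp only [mul_sub, sub_mul, mul_add, add_mul, mul_assoc, mul_zero, zero_mul]; abel))
      gact K * hyy * gact f - gact K * gact f * hdd
      + gact K * hea - hpe - hvy * gact f + hvf * gact D

/-- A homotopy inverse of the image of a cochain map lifts to a cochain map. -/
lemma KerSq.exists_cochainMap_inverse (hF : KerSq F) (dX : GMap X X 1) (dY : GMap Y Y 1)
    (f : GMap X Y 0) (g : GMap Y X 0) (H : GMap X X (-1)) (K : GMap Y Y (-1))
    (hdX : gcomp (one_add_one_eq_two (R := ℤ)) dX dX = 0)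
    (hdY : gcomp (one_add_one_eq_two (R := ℤ)) dY dY = 0)
    (hf : gdelta dX dY (show (0 : ℤ) + 1 = 1 by omega) f = 0)
    (hg : gdelta (Fmap F dY) (Fmap F dX) (show (0 : ℤ) + 1 = 1 by omega) (Fmap F g) = 0)
    (hH : gdelta (Fmap F dX) (Fmap F dX) (show (-1 : ℤ) + 1 = 0 by omega) (Fmap F H)
      = gid (Fgr F X) - gcomp (show (0 : ℤ) + 0 = 0 by omega) (Fmap F f) (Fmap F g))
    (hK : gdelta (Fmap F dY) (Fmap F dY) (show (-1 : ℤ) + 1 = 0 by omega) (Fmap F K)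
      = gid (Fgr F Y) - gcomp (show (0 : ℤ) + 0 = 0 by omega) (Fmap F g) (Fmap F f)) :
    ∃ ψ' : GMap Y X 0, Fmap F ψ' = Fmap F g ∧
      gdelta dY dX (show (0 : ℤ) + 1 = 1 by omega) ψ' = 0 := by
  let s := gdelta dY dX (show (0 : ℤ) + 1 = 1 by omega) g
  let p := gdelta dX dX (show (-1 : ℤ) + 1 = 0 by omega) H
    - (gid X - gcomp (show (0 : ℤ) + 0 = 0 by omega) f g)
  let r := gdelta dY dY (show (-1 : ℤ) + 1 = 0 by omega) K
    - (gid Y - gcomp (show (0 : ℤ) + 0 = 0 by omega) g f)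
  have hs : Fmap F s = 0 := by rw [Fmap_gdelta, hg]
  have hp : Fmap F p = 0 := by
    rw [Fmap_sub, Fmap_sub, Fmap_gdelta, Fmap_gid, Fmap_gcomp, hH, sub_self]
  have hr : Fmap F r = 0 := by
    rw [Fmap_sub, Fmap_sub, Fmap_gdelta, Fmap_gid, Fmap_gcomp, hK, sub_self]
  refine ⟨g - gcomp (show (0 : ℤ) + 0 = 0 by omega) r g
    - gcomp (show (1 : ℤ) + -1 = 0 by omega) s H, ?_, gact_injective ?_⟩
  · rw [Fmap_sub, Fmap_sub, Fmap_gcomp, Fmap_gcomp, hr, hs, zero_gcomp, zero_gcomp, sub_zero,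
      sub_zero]
  have hsr := hF.gact_mul_eq_zero hr hs
  have hps := hF.gact_mul_eq_zero hs hp
  have huX := gact_gid_mul dX
  have hug := gact_gid_mul g
  have hvy := gact_gid_mul dY
  have hyv := gact_mul_gid dY
  have hdd := congrArg gact hdX
  have hyy := congrArg gact hdY
  have hff := congrArg gact hf
  simp only [s, p, r, gact_gcomp, gact_gdelta_zero, gact_gdelta_neg_one, map_sub,
    map_zero] at hsr hps hdd hyy hff ⊢
  linear_combination (norm := (
      simp only [mul_sub, sub_mul, mul_add, add_mul, mul_assoc, mul_zero, zero_mul]; abel))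
      gact H * hdd * gact g - gact H * gact g * hyy
    - hsr - hps - huX * gact g + hug * gact dY
    - gact g * (hyy * gact K - gact K * hyy + hvy - hyv + hff * gact g)

/-- A cochain map whose image has a homotopy inverse that lifts to a cochain map is a homotopy
equivalence. -/
lemma KerSq.exists_isHomotopyEquivPair (hF : KerSq F) (dX : GMap X X 1) (dY : GMap Y Y 1)
    (f : GMap X Y 0) (g : GMap Y X 0) (H : GMap X X (-1)) (K : GMap Y Y (-1))
    (hdX : gcomp (one_add_one_eq_two (R := ℤ)) dX dX = 0)
    (hdY : gcomp (one_add_one_eq_two (R := ℤ)) dY dY = 0)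
    (hf : gdelta dX dY (show (0 : ℤ) + 1 = 1 by omega) f = 0)
    (hg : gdelta dY dX (show (0 : ℤ) + 1 = 1 by omega) g = 0)
    (hH : gdelta (Fmap F dX) (Fmap F dX) (show (-1 : ℤ) + 1 = 0 by omega) (Fmap F H)
      = gid (Fgr F X) - gcomp (show (0 : ℤ) + 0 = 0 by omega) (Fmap F f) (Fmap F g))
    (hK : gdelta (Fmap F dY) (Fmap F dY) (show (-1 : ℤ) + 1 = 0 by omega) (Fmap F K)
      = gid (Fgr F Y) - gcomp (show (0 : ℤ) + 0 = 0 by omega) (Fmap F g) (Fmap F f)) :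
    ∃ g' : GMap Y X 0, IsHomotopyEquivPair dX dY f g' := by
  let p := gdelta dX dX (show (-1 : ℤ) + 1 = 0 by omega) H
    - (gid X - gcomp (show (0 : ℤ) + 0 = 0 by omega) f g)
  let r := gdelta dY dY (show (-1 : ℤ) + 1 = 0 by omega) K
    - (gid Y - gcomp (show (0 : ℤ) + 0 = 0 by omega) g f)
  have hp : Fmap F p = 0 := by
    rw [Fmap_sub, Fmap_sub, Fmap_gdelta, Fmap_gid, Fmap_gcomp, hH, sub_self]
  have hr : Fmap F r = 0 := by
    rw [Fmap_sub, Fmap_sub, Fmap_gdelta, Fmap_gid, Fmap_gcomp, hK, sub_self]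
  have hpp := hF.gact_mul_eq_zero hp hp
  have hrr := hF.gact_mul_eq_zero hr hr
  have hpu := gact_mul_gid p
  have hrv := gact_mul_gid r
  have hux := gact_gid_mul dX
  have hxu := gact_mul_gid dX
  have hvy := gact_gid_mul dY
  have hyv := gact_mul_gid dY
  have hug := gact_gid_mul g
  have hvf := gact_gid_mul f
  have hxx := congrArg gact hdX
  have hyy := congrArg gact hdY
  have hff := congrArg gact hf
  have hgg := congrArg gact hg
  have hp' : gact p = gact dX * gact H + gact H * gact dX
      - (gact (gid X) - gact g * gact f) := by
    simp only [p, gact_gcomp, gact_gdelta_neg_one, map_sub]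
  have hr' : gact r = gact dY * gact K + gact K * gact dY
      - (gact (gid Y) - gact f * gact g) := by
    simp only [r, gact_gcomp, gact_gdelta_neg_one, map_sub]
  simp only [gact_gcomp, gact_gdelta_zero, map_zero] at hxx hyy hff hgg
  have hxp : gact dX * gact p - gact p * gact dX = 0 := by
    rw [hp']
    linear_combination (norm := (
      simp only [mul_sub, sub_mul, mul_add, add_mul, mul_assoc, mul_zero, zero_mul]; abel))
      hxx * gact H - gact H * hxx - hxu + hux
      + hgg * gact f + gact g * hff
  have hyr : gact dY * gact r - gact r * gact dY = 0 := by
    rw [hr']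
    linear_combination (norm := (
      simp only [mul_sub, sub_mul, mul_add, add_mul, mul_assoc, mul_zero, zero_mul]; abel))
      hyy * gact K - gact K * hyy - hyv + hvy
      + hff * gact g + gact f * hgg
  refine ⟨g - gcomp (show (0 : ℤ) + 0 = 0 by omega) g p, hf, gact_injective ?_,
    ⟨H - gcomp (show (-1 : ℤ) + 0 = -1 by omega) H p, gact_injective ?_⟩,
    ⟨K - gcomp (show (-1 : ℤ) + 0 = -1 by omega) K r
      - gcomp (show (0 : ℤ) + -1 = -1 by omega) (gcomp (show (0 : ℤ) + 0 = 0 by omega) g f) K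
      + gcomp (show (-1 : ℤ) + 0 = -1 by omega)
        (gcomp (show (0 : ℤ) + -1 = -1 by omega) g H) f, gact_injective ?_⟩⟩ <;>
  simp only [gact_gcomp, gact_gdelta_zero, gact_gdelta_neg_one, map_sub, map_add, map_zero]
  · linear_combination (norm := (
      simp only [mul_sub, sub_mul, mul_assoc, mul_zero, zero_mul]; abel))
      hgg - hxp * gact g - gact p * hgg
  · linear_combination (norm := (
      simp only [mul_sub, sub_mul, mul_add, mul_assoc, zero_mul]; abel))
      -hp' + gact p * hp' - hpp - hpu - hxp * gact H
  · linear_combination (norm := (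
      simp only [mul_sub, sub_mul, mul_add, add_mul, mul_assoc, mul_zero, zero_mul]; abel))
      -hr' + gact r * hr' - hrr - hrv - hyr * gact K
      + hr' * gact f * gact g - gact f * hp' * gact g - hvf * gact g + gact f * hug
      + gact K * hff * gact g + gact K * gact f * hgg + hff * gact H * gact g
      - gact f * gact H * hgg

end Lifting

/-- every lift of `(C,d)` along `K(F)` is homotopy equivalent, over `φ`, to a
lift carried by the fixed graded lift `C̄`: given a complex `(D̄,d̄_D)` in `𝒞̄` and a
homotopy equivalence `φ : (C,d) → F(D̄,d̄_D)`, there exist a differential `d̄` on `C̄`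
lifting `d` and a homotopy equivalence `ψ : (C̄,d̄) → (D̄,d̄_D)` with `F(ψ)` homotopic
to `φ`. -/
theorem statement15 {B C : Type*} [Category B] [Preadditive B] [Category C] [Preadditive C]
    (F : B ⥤ C) [F.Additive] [F.Full] (hF : KerSq F)
    (Xb Yb : GradedObj B)
    (d : GMap (Fgr F Xb) (Fgr F Xb) 1)
    (hd : gcomp (show (1:ℤ) + 1 = 2 by omega) d d = 0)
    (dYb : GMap Yb Yb 1)
    (hdY : gcomp (show (1:ℤ) + 1 = 2 by omega) dYb dYb = 0)
    (φ : GMap (Fgr F Xb) (Fgr F Yb) 0) (φ' : GMap (Fgr F Yb) (Fgr F Xb) 0)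
    (hφ : IsHomotopyEquivPair d (Fmap F dYb) φ φ') :
    ∃ db : GMap Xb Xb 1, Fmap F db = d ∧
      gcomp (show (1:ℤ) + 1 = 2 by omega) db db = 0 ∧
      ∃ (ψ : GMap Xb Yb 0) (ψ' : GMap Yb Xb 0),
        IsHomotopyEquivPair db dYb ψ ψ' ∧
        ∃ h : GMap (Fgr F Xb) (Fgr F Yb) (-1),
          gdelta d (Fmap F dYb) (show (-1:ℤ) + 1 = 0 by omega) h = φ - Fmap F ψ := by
  obtain ⟨D, rfl⟩ := Fmap_surjective F d
  obtain ⟨f, rfl⟩ := Fmap_surjective F φ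
  obtain ⟨g, rfl⟩ := Fmap_surjective F φ'
  obtain ⟨hf, hg, ⟨H', hH⟩, ⟨K', hK⟩⟩ := hφ
  obtain ⟨H, rfl⟩ := Fmap_surjective F H'
  obtain ⟨K, rfl⟩ := Fmap_surjective F K'
  obtain ⟨D₁, hD₁, hD₁sq⟩ := hF.exists_differential D dYb f g H hd hdY hf hg hH
  rw [← hD₁] at hf hg hH ⊢
  obtain ⟨db, ψ, hdb, hψ, hdbsq, hψd⟩ := hF.exists_cochainMap D₁ dYb f g K hD₁sq hdY hf hg hK
  rw [← hdb] at hg hH ⊢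
  rw [← hψ] at hH hK ⊢
  obtain ⟨g₁, hg₁, hg₁d⟩ := hF.exists_cochainMap_inverse db dYb ψ g H K hdbsq hdY hψd hg hH hK
  rw [← hg₁] at hH hK
  obtain ⟨ψ', hψ'⟩ := hF.exists_isHomotopyEquivPair db dYb ψ g₁ H K hdbsq hdY hψd hg₁d hH hK
  refine ⟨db, rfl, hdbsq, ψ, ψ', hψ', 0, ?_⟩
  rw [gdelta, gcomp_zero, zero_gcomp, smul_zero, sub_self, sub_self]

end Paper
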